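/- Let α > 0 be a real number with α ∉ √2·ℚ, with H₄-expansion data G_n = (t_n, v_n; u_n, w_n), α_n = (w_n·α − v_n)/(t_n − u_n·α), α*_n = w_n/u_n, and let n ≥ m(α)+1. If α_n > 1 and α*_n > 1, then |α − t_n/u_n| < 1/(2·u_n²). If α_n < 1 and α*_n < 1, then |α − v_n/w_n| < 1/(2·w_n²). -/

import Mathlib

/-- A matrix (p, r; q, s) has the first H4 form (without sign). -/
def H4form (p r q s : ℝ) : Prop :=
  (∃ a b c d : ℤ, Odd a ∧ Odd d ∧ a * d - 2 * b * c = 1 ∧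
     p = (a : ℝ) ∧ r = Real.sqrt 2 * b ∧ q = Real.sqrt 2 * c ∧ s = (d : ℝ)) ∨
  (∃ a b c d : ℤ, Odd b ∧ Odd c ∧ 2 * a * d - b * c = 1 ∧
     p = Real.sqrt 2 * a ∧ r = (b : ℝ) ∧ q = (c : ℝ) ∧ s = Real.sqrt 2 * d)

/-- The matrix (p, r; q, s) belongs to the Hecke group H4 (up to sign). -/
def H4 (p r q s : ℝ) : Prop := H4form p r q s ∨ H4form (-p) (-r) (-q) (-s)

/-- p/q ∈ ℚ(H₄): q > 0 and (p, r; q, s) ∈ H₄ for some reals r, s. -/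
def QH4 (p q : ℝ) : Prop := 0 < q ∧ ∃ r s : ℝ, H4 p r q s

/-- α ∉ √2·ℚ. -/
def NotSqrt2Rat (α : ℝ) : Prop := ¬ ∃ x : ℚ, α = Real.sqrt 2 * (x : ℝ)

/-- The matrices A₁, A₂, A₃ generating the H₄-expansion. -/
noncomputable def Amat : ℕ → Matrix (Fin 2) (Fin 2) ℝ
  | 1 => !![1, 0; Real.sqrt 2, 1]
  | 2 => !![Real.sqrt 2, 1; 1, Real.sqrt 2]
  | _ => !![1, Real.sqrt 2; 0, 1]

/-- G_n = A_{d₁} ⋯ A_{d_n}. -/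
noncomputable def Gmat (d : ℕ → ℕ) (n : ℕ) : Matrix (Fin 2) (Fin 2) ℝ :=
  ((List.range n).map (fun i => Amat (d (i + 1)))).prod

noncomputable def tn (d : ℕ → ℕ) (n : ℕ) : ℝ := Gmat d n 0 0
noncomputable def vn (d : ℕ → ℕ) (n : ℕ) : ℝ := Gmat d n 0 1
noncomputable def un (d : ℕ → ℕ) (n : ℕ) : ℝ := Gmat d n 1 0
noncomputable def wn (d : ℕ → ℕ) (n : ℕ) : ℝ := Gmat d n 1 1

/-- α_n = G_n⁻¹ · α. -/
noncomputable def alphan (d : ℕ → ℕ) (α : ℝ) (n : ℕ) : ℝ :=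
  (wn d n * α - vn d n) / (tn d n - un d n * α)

/-- α*_n = w_n / u_n. -/
noncomputable def alphast (d : ℕ → ℕ) (n : ℕ) : ℝ := wn d n / un d n

theorem Gmat_succ (d : ℕ → ℕ) (n : ℕ) : Gmat d (n + 1) = Gmat d n * Amat (d (n + 1)) := by
  simp [Gmat, List.range_succ]

theorem det_Amat {k : ℕ} (hk : k = 1 ∨ k = 2 ∨ k = 3) : (Amat k).det = 1 := by
  rcases hk with rfl | rfl | rfl <;> simp [Amat, Matrix.det_fin_two]
  norm_num

theorem det_Gmat {d : ℕ → ℕ} (hd : ∀ n : ℕ, 1 ≤ n → d n = 1 ∨ d n = 2 ∨ d n = 3) (n : ℕ) :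
    (Gmat d n).det = 1 := by
  induction n with
  | zero => simp [Gmat]
  | succ n ih => rw [Gmat_succ, Matrix.det_mul, ih, det_Amat (hd _ (by omega)), one_mul]

theorem un_nonneg_and_wn_pos {d : ℕ → ℕ} (hd : ∀ n : ℕ, 1 ≤ n → d n = 1 ∨ d n = 2 ∨ d n = 3)
    (n : ℕ) : 0 ≤ un d n ∧ 0 < wn d n := by
  induction n with
  | zero => simp [un, wn, Gmat]
  | succ n ih =>
    obtain ⟨hu, hw⟩ := ih
    simp only [un, wn] at hu hw
    rcases hd (n + 1) (by omega) with h | h | h <;>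
      simp only [un, wn, Gmat_succ, h, Amat, Matrix.mul_apply, Fin.sum_univ_two] <;>
      constructor <;> simp <;> positivity

theorem un_succ_pos {d : ℕ → ℕ} (hd : ∀ n : ℕ, 1 ≤ n → d n = 1 ∨ d n = 2 ∨ d n = 3) {n : ℕ}
    (h : 0 < un d n ∨ d (n + 1) ≠ 3) : 0 < un d (n + 1) := by
  obtain ⟨hu, hw⟩ := un_nonneg_and_wn_pos hd n
  simp only [un, wn] at h hu hw
  rcases hd (n + 1) (by omega) with h' | h' | h' <;>
    simp only [un, Gmat_succ, h', Amat, Matrix.mul_apply, Fin.sum_univ_two] <;> simp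
  · positivity
  · positivity
  · simpa [h'] using h

theorem un_pos {d : ℕ → ℕ} (hd : ∀ n : ℕ, 1 ≤ n → d n = 1 ∨ d n = 2 ∨ d n = 3) {m n : ℕ}
    (hm : d (m + 1) ≠ 3) (hn : m + 1 ≤ n) : 0 < un d n := by
  induction n, hn using Nat.le_induction with
  | base => exact un_succ_pos hd (.inr hm)
  | succ n _ ih => exact un_succ_pos hd (.inl ih)

theorem good_approximation (α : ℝ) (hα : 0 < α) (hirr : NotSqrt2Rat α)
    (d : ℕ → ℕ)
    (hd : ∀ n : ℕ, 1 ≤ n → d n = 1 ∨ d n = 2 ∨ d n = 3)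
    (hmem : ∀ n : ℕ, 1 ≤ n → vn d n < wn d n * α ∧ un d n * α < tn d n)
    (m : ℕ) (hm : ∀ n : ℕ, 1 ≤ n → n ≤ m → d n = 3) (hm1 : d (m + 1) ≠ 3)
    (n : ℕ) (hn : m + 1 ≤ n) :
    (1 < alphan d α n → 1 < alphast d n →
      |α - tn d n / un d n| < 1 / (2 * (un d n) ^ 2)) ∧
    (alphan d α n < 1 → alphast d n < 1 →
      |α - vn d n / wn d n| < 1 / (2 * (wn d n) ^ 2)) := by
  have hu : 0 < un d n := un_pos hd hm1 hn
  have hw : 0 < wn d n := (un_nonneg_and_wn_pos hd n).2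
  have hdet : tn d n * wn d n - vn d n * un d n = 1 := by
    simpa [Matrix.det_fin_two, tn, vn, un, wn] using det_Gmat hd n
  obtain ⟨hX, hY⟩ := hmem n (by omega)
  unfold alphan alphast
  have hY' : 0 < tn d n - un d n * α := sub_pos.2 hY
  generalize tn d n = t at *
  generalize un d n = u at *
  generalize vn d n = v at *
  generalize wn d n = w at *
  constructor
  · intro h1 h2
    rw [one_lt_div hY'] at h1
    rw [one_lt_div hu] at h2
    have key : α - t / u = -((t - u * α) / u) := by field_simp; ring
    rw [key, abs_neg, abs_of_pos (div_pos hY' hu), div_lt_div_iff₀ hu (by positivity)]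
    have : 2 * u * (t - u * α) < 1 := by
      nlinarith [mul_pos hu (sub_pos.2 h1), mul_pos hY' (sub_pos.2 h2)]
    nlinarith
  · intro h1 h2
    rw [div_lt_one hY'] at h1
    rw [div_lt_one hu] at h2
    have hX' : 0 < w * α - v := sub_pos.2 hX
    have key : α - v / w = (w * α - v) / w := by field_simp
    rw [key, abs_of_pos (div_pos hX' hw), div_lt_div_iff₀ hw (by positivity)]
    have : 2 * w * (w * α - v) < 1 := by
      nlinarith [mul_pos hw (sub_pos.2 h1), mul_pos hX' (sub_pos.2 h2)]
    nlinarith
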